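/- A forest is a caterpillar (i.e., it contains a path such that every vertex is at distance at most 1 from this path) if and only if it does not contain the spider S_{1,1,1} — the tree obtained from K_{1,3} by subdividing each edge once — as a subgraph. -/

import Mathlib

open SimpleGraph in
theorem cat_arm {V : Type*} {G : SimpleGraph V} {z v : V} (q : G.Walk z v) (hq : q.IsPath)
    (h2 : 2 ≤ q.length) : ∃ a b, G.Adj z a ∧ G.Adj a b ∧ a ∈ q.support.tail ∧
      b ∈ q.support.tail ∧ a ≠ b ∧ z ≠ a ∧ z ≠ b := by
  cases q with
  | nil => simp at h2
  | cons h r =>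
    cases r with
    | nil => simp at h2
    | cons h' s =>
      refine ⟨_, _, h, h', by simp, by simp, h'.ne, h.ne, ?_⟩
      rintro rfl
      rw [Walk.cons_isPath_iff] at hq
      exact hq.2 (by simp)

/-- Connected by a walk avoiding `c`. -/
def CatAvoid {V : Type*} (G : SimpleGraph V) (c x y : V) : Prop :=
  ∃ p : G.Walk x y, c ∉ p.support

theorem CatAvoid.symm {V : Type*} {G : SimpleGraph V} {c x y : V} (h : CatAvoid G c x y) :
    CatAvoid G c y x := by
  obtain ⟨p, hp⟩ := h
  exact ⟨p.reverse, by simpa using hp⟩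

theorem CatAvoid.trans {V : Type*} {G : SimpleGraph V} {c x y z : V} (h : CatAvoid G c x y)
    (h' : CatAvoid G c y z) : CatAvoid G c x z := by
  obtain ⟨p, hp⟩ := h
  obtain ⟨q, hq⟩ := h'
  exact ⟨p.append q, by simp [SimpleGraph.Walk.mem_support_append_iff, hp, hq]⟩

theorem cat_avoid_of_mem {V : Type*} {G : SimpleGraph V} {c u v x y : V} (p : G.Walk u v)
    (hc : c ∉ p.support) (hx : x ∈ p.support) (hy : y ∈ p.support) : CatAvoid G c x y := by
  classical
  have key : ∀ w ∈ p.support, CatAvoid G c u w := fun w hw =>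
    ⟨p.takeUntil w hw, fun h => hc (p.support_takeUntil_subset_support hw h)⟩
  exact (key x hx).symm.trans (key y hy)

theorem cat_avoid_of_mem_start {V : Type*} {G : SimpleGraph V} {c v x y : V} (p : G.Walk c v)
    (hp : p.IsPath) (hx : x ∈ p.support) (hy : y ∈ p.support) (hxc : x ≠ c) (hyc : y ≠ c) :
    CatAvoid G c x y := by
  cases p with
  | nil => simp at hx; exact absurd hx hxc
  | cons h r =>
    rw [SimpleGraph.Walk.cons_isPath_iff] at hp
    simp [hxc] at hx
    simp [hyc] at hy
    exact cat_avoid_of_mem r hp.2 hx hy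

theorem cat_branch {V : Type*} {G : SimpleGraph V} (hG : G.IsAcyclic) {c x y : V}
    (hx : G.Adj c x) (hy : G.Adj c y) (h : CatAvoid G c x y) : x = y := by
  classical
  obtain ⟨p, hp⟩ := h
  have h1 : (SimpleGraph.Walk.cons hx p.bypass).IsPath := by
    rw [SimpleGraph.Walk.cons_isPath_iff]
    exact ⟨p.bypass_isPath, fun h => hp (p.support_bypass_subset_support h)⟩
  have h2 : (SimpleGraph.Walk.cons hy SimpleGraph.Walk.nil).IsPath := by
    simp [SimpleGraph.Walk.cons_isPath_iff, hy.ne]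
  have h3 := congrArg (fun q => q.1.length) (hG.path_unique ⟨_, h1⟩ ⟨_, h2⟩)
  simp at h3
  exact SimpleGraph.Walk.eq_of_length_eq_zero (p := p.bypass) (by simpa using h3)

theorem cat_pigeon {V : Type*} (S T : V → Prop) (f : Fin 3 → V) (h : ∀ i, S (f i) ∨ T (f i)) :
    ∃ i j, i ≠ j ∧ ((S (f i) ∧ S (f j)) ∨ (T (f i) ∧ T (f j))) := by
  have h0 := h 0
  have h1 := h 1
  have h2 := h 2
  by_cases a : S (f 0) <;> by_cases b : S (f 1)
  · exact ⟨0, 1, by decide, Or.inl ⟨a, b⟩⟩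
  · rcases h2 with h2 | h2
    · exact ⟨0, 2, by decide, Or.inl ⟨a, h2⟩⟩
    · exact ⟨1, 2, by decide, Or.inr ⟨h1.resolve_left b, h2⟩⟩
  · rcases h2 with h2 | h2
    · exact ⟨1, 2, by decide, Or.inl ⟨b, h2⟩⟩
    · exact ⟨0, 2, by decide, Or.inr ⟨h0.resolve_left a, h2⟩⟩
  · exact ⟨0, 1, by decide, Or.inr ⟨h0.resolve_left a, h1.resolve_left b⟩⟩

theorem cat_boundary {V : Type*} {G : SimpleGraph V} (D : V → Prop) {w u : V} (p : G.Walk w u)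
    (hw : ¬ D w) (hu : D u) : ∃ y x, G.Adj y x ∧ ¬ D y ∧ D x ∧ G.Reachable w y := by
  induction p with
  | nil => exact absurd hu hw
  | @cons a b c h r ih =>
    by_cases hb : D b
    · exact ⟨a, b, h, hw, hb, SimpleGraph.Reachable.refl _⟩
    · obtain ⟨y, x, h1, h2, h3, h4⟩ := ih hb hu
      exact ⟨y, x, h1, h2, h3, h.reachable.trans h4⟩


/-- A forest is a caterpillar (each connected component has a path such that
every vertex of the component is on the path or adjacent to it) if and only if
it does not contain the spider `S_{1,1,1}` (the tree obtained from `K_{1,3}` by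
subdividing each edge once) as a subgraph. -/
theorem caterpillar_iff_no_spider {V : Type*} [Fintype V] (G : SimpleGraph V)
    (hG : G.IsAcyclic) :
    (∀ c : G.ConnectedComponent, ∃ (u v : V) (p : G.Walk u v), p.IsPath ∧
        G.connectedComponentMk u = c ∧
        ∀ w : V, G.connectedComponentMk w = c →
          w ∈ p.support ∨ ∃ x ∈ p.support, G.Adj w x) ↔
      ¬ ∃ (center : V) (a b : Fin 3 → V),
        (∀ i, G.Adj center (a i) ∧ G.Adj (a i) (b i)) ∧
        Function.Injective a ∧ Function.Injective b ∧
        (∀ i j, a i ≠ b j) ∧ (∀ i, center ≠ a i ∧ center ≠ b i) := by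
  classical
  constructor
  · rintro hcat ⟨c, a, b, hadj, ha, hb, hab, hc⟩
    obtain ⟨u, v, p, hp, hu, hdom⟩ := hcat (G.connectedComponentMk c)
    have key : ∀ i, ∃ y ∈ p.support, y ≠ c ∧ CatAvoid G c (a i) y := by
      intro i
      have hcb : ¬ G.Adj c (b i) := by
        intro h
        refine (hadj i).2.ne (cat_branch hG (hadj i).1 h
          ⟨SimpleGraph.Walk.cons (hadj i).2 SimpleGraph.Walk.nil, ?_⟩)
        simp [(hc i).1, (hc i).2]
      have hav : CatAvoid G c (a i) (b i) :=
        ⟨SimpleGraph.Walk.cons (hadj i).2 SimpleGraph.Walk.nil, by simp [(hc i).1, (hc i).2]⟩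
      rcases hdom (b i) (SimpleGraph.ConnectedComponent.sound
        ((hadj i).1.reachable.trans (hadj i).2.reachable).symm) with h | ⟨x, hx, hbx⟩
      · exact ⟨b i, h, (hc i).2.symm, hav⟩
      · have hxc : x ≠ c := by
          rintro rfl
          exact hcb hbx.symm
        exact ⟨x, hx, hxc, hav.trans
          ⟨SimpleGraph.Walk.cons hbx SimpleGraph.Walk.nil, by simp [(hc i).2, hxc.symm]⟩⟩
    choose y hy hyc hay using key
    have fin : ∀ i j, i ≠ j → ¬ CatAvoid G c (y i) (y j) := fun i j hij h =>
      hij (ha (cat_branch hG (hadj i).1 (hadj j).1 (((hay i).trans h).trans (hay j).symm)))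
    by_cases hcp : c ∈ p.support
    · have hspec := p.take_spec hcp
      obtain ⟨i, j, hij, h⟩ := cat_pigeon (fun x => x ∈ (p.takeUntil c hcp).reverse.support)
        (fun x => x ∈ (p.dropUntil c hcp).support) y (by
          intro i
          have := hy i
          rw [← hspec, SimpleGraph.Walk.mem_support_append_iff] at this
          simpa using this)
      rcases h with h | h
      · exact fin i j hij (cat_avoid_of_mem_start _ (hp.takeUntil hcp).reverse h.1 h.2
          (hyc i) (hyc j))
      · exact fin i j hij (cat_avoid_of_mem_start _ (hp.dropUntil hcp) h.1 h.2
          (hyc i) (hyc j))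
    · exact fin 0 1 (by decide) (cat_avoid_of_mem p hcp (hy 0) (hy 1))
  · intro hno c
    let L : Set ℕ := {n | ∃ (u v : V) (p : G.Walk u v), p.IsPath ∧
      G.connectedComponentMk u = c ∧ p.length = n}
    have hne : L.Nonempty := by
      obtain ⟨u, hu⟩ := c.exists_rep
      exact ⟨0, u, u, SimpleGraph.Walk.nil, by simp, hu, rfl⟩
    have hbd : BddAbove L := by
      refine ⟨Fintype.card V, ?_⟩
      rintro n ⟨u, v, p, hp, -, rfl⟩
      exact hp.length_lt.le
    obtain ⟨u, v, p, hp, hu, hlen⟩ := Nat.sSup_mem hne hbd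
    have hmax : ∀ (u' v' : V) (p' : G.Walk u' v'), p'.IsPath →
        G.connectedComponentMk u' = c → p'.length ≤ p.length := by
      intro u' v' p' h1 h2
      rw [hlen]
      exact le_csSup hbd ⟨u', v', p', h1, h2, rfl⟩
    refine ⟨u, v, p, hp, hu, ?_⟩
    intro w hw
    by_contra hcon
    obtain ⟨W⟩ : G.Reachable w u := SimpleGraph.ConnectedComponent.exact (hw.trans hu.symm)
    obtain ⟨y, x, hyx, hDy, hDx, hwy⟩ := cat_boundary
      (fun w => w ∈ p.support ∨ ∃ x ∈ p.support, G.Adj w x) W hcon (Or.inl p.start_mem_support)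
    have hyp : y ∉ p.support := fun h => hDy (Or.inl h)
    have hxp : x ∉ p.support := fun h => hDy (Or.inr ⟨x, h, hyx⟩)
    obtain ⟨z, hz, hxz⟩ := hDx.resolve_left hxp
    have hyc : G.connectedComponentMk y = c :=
      (SimpleGraph.ConnectedComponent.sound hwy.symm).trans hw
    have hspec := p.take_spec hz
    have hp1 := (hp.takeUntil hz)
    have hp2 := (hp.dropUntil hz)
    have hs1 : ∀ t ∈ (p.takeUntil z hz).support, t ∈ p.support :=
      fun t ht => p.support_takeUntil_subset_support hz ht
    have hs2 : ∀ t ∈ (p.dropUntil z hz).support, t ∈ p.support :=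
      fun t ht => p.support_dropUntil_subset_support hz ht
    generalize p.takeUntil z hz = q1 at *
    generalize p.dropUntil z hz = q2 at *
    have hl : p.length = q1.length + q2.length := by
      rw [← hspec, SimpleGraph.Walk.length_append]
    have ext : ∀ (v' : V) (q : G.Walk z v'), q.IsPath → (∀ t ∈ q.support, t ∈ p.support) →
        q.length + 2 ≤ p.length := by
      intro v' q hq hs
      refine hmax _ _ (SimpleGraph.Walk.cons hyx (SimpleGraph.Walk.cons hxz q)) ?_ hyc
      rw [SimpleGraph.Walk.cons_isPath_iff, SimpleGraph.Walk.cons_isPath_iff]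
      refine ⟨⟨hq, fun h => hxp (hs _ h)⟩, ?_⟩
      rw [SimpleGraph.Walk.support_cons, List.mem_cons]
      rintro (h | h)
      · exact hyx.ne h
      · exact hyp (hs _ h)
    have e2 := ext _ q2 hp2 hs2
    have e1 := ext _ q1.reverse hp1.reverse (by simpa using hs1)
    rw [SimpleGraph.Walk.length_reverse] at e1
    obtain ⟨a1, b1, h1, h1', m1, m1', n1, n1', n1''⟩ := cat_arm q1.reverse hp1.reverse
      (by rw [SimpleGraph.Walk.length_reverse]; omega)
    obtain ⟨a2, b2, h2, h2', m2, m2', n2, n2', n2''⟩ := cat_arm q2 hp2 (by omega)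
    replace m1 : a1 ∈ q1.support := by simpa using List.mem_of_mem_tail m1
    replace m1' : b1 ∈ q1.support := by simpa using List.mem_of_mem_tail m1'
    have hnd := hp.support_nodup
    rw [← hspec, SimpleGraph.Walk.support_append, List.nodup_append] at hnd
    have hd := hnd.2.2
    have d1 := hd _ m1 _ m2
    have d2 := hd _ m1 _ m2'
    have d3 := hd _ m1' _ m2
    have d4 := hd _ m1' _ m2'
    have P1 := hs1 _ m1
    have P2 := hs1 _ m1'
    have P3 := hs2 _ (List.mem_of_mem_tail m2)
    have P4 := hs2 _ (List.mem_of_mem_tail m2')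
    have off : ∀ t ∈ p.support, x ≠ t ∧ y ≠ t := fun t ht =>
      ⟨fun h => hxp (h ▸ ht), fun h => hyp (h ▸ ht)⟩
    have o1 := off _ P1
    have o2 := off _ P2
    have o3 := off _ P3
    have o4 := off _ P4
    have o5 := off _ hz
    refine hno ⟨z, ![x, a1, a2], ![y, b1, b2], ?_, ?_, ?_, ?_, ?_⟩
    · intro i
      fin_cases i
      · exact ⟨hxz.symm, hyx.symm⟩
      · exact ⟨h1, h1'⟩
      · exact ⟨h2, h2'⟩
    · intro i j hij
      fin_cases i <;> fin_cases j <;> simp at hij ⊢ <;> grind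
    · intro i j hij
      fin_cases i <;> fin_cases j <;> simp at hij ⊢ <;> grind
    · have := hyx.ne
      intro i j
      fin_cases i <;> fin_cases j <;> simp <;> grind
    · intro i
      fin_cases i <;> simp <;> grind
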